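/- Let N be a positive integer and b, c, d, e' complex numbers with Re(e'-N+b+c-2d) > 0 (and no denominator parameter a nonpositive integer). Then Σ_{m,n} (-N)_m(b)_m(c)_m (d+N)_n(d-b)_n(d-c)_n / ((d)_{m+n}(1-N+b+c-d)_m(e')_n m! n!) = [(d-b)_N (d-c)_N (1+d-e')_N / ((d)_N (d-b-c)_N (1+2d-b-c-e')_N)] · Γ(e')Γ(e'+b+c-2d) / (Γ(e'+b-d)Γ(e'+c-d)). -/

import Mathlib

open Complex Finset

/-- Pochhammer symbol `(a)_k = a(a+1)⋯(a+k-1)`. -/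
noncomputable def poch (a : ℂ) (k : ℕ) : ℂ := ∏ i ∈ Finset.range k, (a + i)

/-- `z` is not a nonpositive integer. -/
def notNonposInt (z : ℂ) : Prop := ∀ k : ℕ, z ≠ -(k : ℂ)


theorem poch_zero (a : ℂ) : poch a 0 = 1 := by simp [poch]

theorem poch_succ (a : ℂ) (n : ℕ) : poch a (n + 1) = poch a n * (a + n) := by
  simp [poch, Finset.prod_range_succ]

theorem poch_add (a : ℂ) (m n : ℕ) : poch a (m + n) = poch a m * poch (a + m) n := by
  simp only [poch, Finset.prod_range_add]
  congr 1
  refine Finset.prod_congr rfl fun i _ => ?_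
  push_cast; ring

theorem poch_succ' (a : ℂ) (n : ℕ) : poch a (n + 1) = a * poch (a + 1) n := by
  rw [add_comm n 1, poch_add]
  simp [poch]

theorem poch_ne_zero {a : ℂ} (h : notNonposInt a) (n : ℕ) : poch a n ≠ 0 := by
  rw [poch, Finset.prod_ne_zero_iff]
  intro i _ h0
  exact h i (eq_neg_of_add_eq_zero_left h0)

theorem poch_one (n : ℕ) : poch 1 n = (n.factorial : ℂ) := by
  induction n with
  | zero => simp [poch]
  | succ k ih => rw [poch_succ, ih, Nat.factorial_succ]; push_cast; ring

/-- reflection -/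
theorem poch_reflect (a : ℂ) (n : ℕ) : poch (1 - n - a) n = (-1) ^ n * poch a n := by
  rw [poch, poch, ← Finset.prod_range_reflect, ← Finset.card_range n, ← Finset.prod_const,
    Finset.card_range, ← Finset.prod_mul_distrib]
  refine Finset.prod_congr rfl fun i hi => ?_
  have hi' := Finset.mem_range.mp hi
  have : ((n - 1 - i : ℕ) : ℂ) = n - 1 - i := by
    rw [Nat.cast_sub (by omega), Nat.cast_sub (by omega)]; simp
  rw [this]; ring

theorem pascal_sum (f : ℕ → ℕ → ℂ) (n : ℕ) :
    (∑ ij ∈ antidiagonal (n + 1), ((n + 1).choose ij.1 : ℂ) * f ij.1 ij.2) =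
      ∑ ij ∈ antidiagonal n, (n.choose ij.1 : ℂ) * (f ij.1 (ij.2 + 1) + f (ij.1 + 1) ij.2) := by
  rw [Finset.sum_antidiagonal_choose_succ_mul, ← Finset.sum_add_distrib]
  refine Finset.sum_congr rfl fun p hp => ?_
  rw [Nat.choose_symm_of_eq_add (HasAntidiagonal.mem_antidiagonal.mp hp).symm]
  ring

theorem vandermonde1 (M : ℕ) (a b : ℂ) :
    ∑ p ∈ antidiagonal M, (M.choose p.1 : ℂ) * (poch a p.1 * poch b p.2) = poch (a + b) M := by
  induction M with
  | zero => simp [poch]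
  | succ M ih =>
    rw [pascal_sum (fun i j => poch a i * poch b j), poch_succ, ← ih, Finset.sum_mul]
    refine Finset.sum_congr rfl fun p hp => ?_
    have h : ((p.1 : ℂ) + p.2) = M := by exact_mod_cast (HasAntidiagonal.mem_antidiagonal.mp hp)
    rw [← h, poch_succ, poch_succ]; ring

theorem vandermonde2 (M : ℕ) (x A : ℂ) :
    ∑ p ∈ antidiagonal M, (M.choose p.1 : ℂ) * ((-1) ^ p.1 * poch x p.1 * poch (A + p.1) p.2)
      = poch (A - x) M := by
  induction M generalizing A with
  | zero => simp [poch]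
  | succ M ih =>
    rw [pascal_sum (fun i j => (-1) ^ i * poch x i * poch (A + i) j), poch_succ',
      show A - x + 1 = (A + 1) - x by ring, ← ih, Finset.mul_sum]
    refine Finset.sum_congr rfl fun p hp => ?_
    rw [poch_succ' (A + p.1), poch_succ x]
    push_cast
    rw [show A + ((p.1 : ℂ) + 1) = A + 1 + p.1 by ring, show A + (p.1 : ℂ) + 1 = A + 1 + p.1 by ring]
    ring

theorem saal (b c : ℂ) (M : ℕ) : ∀ D : ℂ,
    ∑ p ∈ antidiagonal M, (M.choose p.1 : ℂ) *
      (poch b p.1 * poch c p.1 * poch (D + p.1) p.2 * poch (D - b - c) p.2)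
      = poch (D - b) M * poch (D - c) M := by
  induction M using Nat.strong_induction_on with
  | _ M ih =>
  rcases M with _ | M
  · intro D; simp [poch]
  intro D
  have ihM := ih M (by omega) D
  rw [pascal_sum (fun i j => poch b i * poch c i * poch (D + i) j * poch (D - b - c) j)]
  have key : ∑ p ∈ antidiagonal M, (M.choose p.1 : ℂ) *
      (poch b p.1 * poch c p.1 * poch (D + 1 + p.1) p.2 * poch (D - b - c) p.2)
      = (poch (D - b) M * poch (D - c) M)
        + M * (D - b - c) *
          (if M = 0 then 0 else poch (D + 1 - b) (M - 1) * poch (D + 1 - c) (M - 1)) := by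
    rw [← ihM]
    rcases M with _ | K
    · simp [poch]
    have ihK := ih K (by omega) (D + 1)
    simp only [Nat.add_eq_zero_iff, one_ne_zero, and_false, if_false, Nat.add_sub_cancel]
    rw [← ihK, ← sub_eq_iff_eq_add', ← Finset.sum_sub_distrib, Finset.Nat.sum_antidiagonal_succ',
      Finset.mul_sum]
    simp only [poch_zero, sub_self, zero_add]
    refine Finset.sum_congr rfl fun p hp => ?_
    have h : p.1 + p.2 = K := HasAntidiagonal.mem_antidiagonal.mp hp
    have hc : ((K + 1).choose p.1 : ℂ) * (p.2 + 1) = K.choose p.1 * (K + 1) := by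
      have := Nat.choose_mul_succ_eq K p.1
      rw [show K + 1 - p.1 = p.2 + 1 by omega] at this
      exact_mod_cast this.symm
    have e1 : poch (D - b - c) (p.2 + 1) = (D - b - c) * poch (D + 1 - b - c) p.2 := by
      rw [poch_succ']; ring_nf
    have e2 : poch (D + p.1) (p.2 + 1) = (D + p.1) * poch (D + 1 + p.1) p.2 := by
      rw [poch_succ']; ring_nf
    rw [e1, e2, poch_succ (D + 1 + p.1)]
    push_cast
    linear_combination (poch b p.1 * poch c p.1 * poch (D + 1 + p.1) p.2 * (D - b - c) *
      poch (D + 1 - b - c) p.2) * hc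
  have hsum : ∑ p ∈ antidiagonal M, (M.choose p.1 : ℂ) *
      (poch b p.1 * poch c p.1 * poch (D + p.1) (p.2 + 1) * poch (D - b - c) (p.2 + 1) +
        poch b (p.1 + 1) * poch c (p.1 + 1) * poch (D + (p.1 + 1 : ℕ)) p.2 * poch (D - b - c) p.2)
      = (D - b) * (D - c) * ∑ p ∈ antidiagonal M, (M.choose p.1 : ℂ) *
      (poch b p.1 * poch c p.1 * poch (D + 1 + p.1) p.2 * poch (D - b - c) p.2)
       + M * (D + M) * ∑ p ∈ antidiagonal M, (M.choose p.1 : ℂ) *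
      (poch b p.1 * poch c p.1 * poch (D + p.1) p.2 * poch (D - b - c) p.2) := by
    rw [Finset.mul_sum, Finset.mul_sum, ← Finset.sum_add_distrib]
    refine Finset.sum_congr rfl fun p hp => ?_
    have h : ((p.1 : ℂ) + p.2) = M := by exact_mod_cast (HasAntidiagonal.mem_antidiagonal.mp hp)
    have e2 : poch (D + p.1) (p.2 + 1) = (D + p.1) * poch (D + 1 + p.1) p.2 := by
      rw [poch_succ']; ring_nf
    have e3 : (D + p.1) * poch (D + 1 + p.1) p.2 = poch (D + p.1) p.2 * (D + p.1 + p.2) := by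
      rw [← e2, poch_succ]
    rw [e2, poch_succ b, poch_succ c, poch_succ (D - b - c)]
    push_cast
    rw [show D + ((p.1 : ℂ) + 1) = D + 1 + p.1 by ring, ← h]
    linear_combination (M.choose p.1 : ℂ) * (poch b p.1 * poch c p.1 * poch (D - b - c) p.2) *
      (p.1 + p.2) * e3
  rw [hsum, key, ihM]
  rcases M with _ | K
  · simp [poch]
  simp only [Nat.add_eq_zero_iff, one_ne_zero, and_false, if_false, Nat.add_sub_cancel]
  rw [poch_succ (D - b) (K + 1), poch_succ (D - c) (K + 1)]
  have f1 : poch (D - b) (K + 1) = (D - b) * poch (D + 1 - b) K := by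
    rw [poch_succ']; ring_nf
  have f2 : poch (D - c) (K + 1) = (D - c) * poch (D + 1 - c) K := by
    rw [poch_succ']; ring_nf
  rw [f1, f2]; push_cast; ring

theorem choose_swap (m j k : ℕ) :
    ((m + (j + k)).choose m) * ((j + k).choose j) =
    ((j + (m + k)).choose j) * ((m + k).choose m) := by
  have h1 := Nat.choose_mul (n := m + (j + k)) (k := m + j) (s := m) (by omega)
  have h2 := Nat.choose_mul (n := j + (m + k)) (k := m + j) (s := j) (by omega)
  rw [show m + (j + k) - m = j + k by omega, show m + j - m = j by omega] at h1
  rw [show j + (m + k) - j = m + k by omega, show m + j - j = m by omega] at h2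
  rw [← h1, ← h2, show m + (j + k) = j + (m + k) by omega]
  congr 1
  exact Nat.choose_symm_of_eq_add rfl

theorem triple_swap (N : ℕ) (F : ℕ → ℕ → ℕ → ℂ) :
    ∑ p ∈ antidiagonal N, ∑ q ∈ antidiagonal p.2, F p.1 q.1 q.2 =
    ∑ p ∈ antidiagonal N, ∑ q ∈ antidiagonal p.2, F q.1 p.1 q.2 := by
  rw [Finset.sum_sigma', Finset.sum_sigma']
  refine Finset.sum_nbij' (fun s => ⟨(s.2.1, s.1.1 + s.2.2), (s.1.1, s.2.2)⟩)
    (fun s => ⟨(s.2.1, s.1.1 + s.2.2), (s.1.1, s.2.2)⟩) ?_ ?_ ?_ ?_ ?_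
  · rintro ⟨⟨a, b⟩, ⟨c, d⟩⟩ h
    simp only [mem_sigma, HasAntidiagonal.mem_antidiagonal] at h ⊢; obtain ⟨h1, h2⟩ := h; grind
  · rintro ⟨⟨a, b⟩, ⟨c, d⟩⟩ h
    simp only [mem_sigma, HasAntidiagonal.mem_antidiagonal] at h ⊢; obtain ⟨h1, h2⟩ := h; grind
  · rintro ⟨⟨a, b⟩, ⟨c, d⟩⟩ h
    simp only [mem_sigma, HasAntidiagonal.mem_antidiagonal] at h ⊢
    obtain ⟨_, rfl⟩ := h; rfl
  · rintro ⟨⟨a, b⟩, ⟨c, d⟩⟩ h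
    simp only [mem_sigma, HasAntidiagonal.mem_antidiagonal] at h ⊢
    obtain ⟨_, rfl⟩ := h; rfl
  · rintro ⟨⟨a, b⟩, ⟨c, d⟩⟩ h
    rfl

theorem L_identity (N : ℕ) (b c d x : ℂ) :
    ∑ p ∈ antidiagonal N, (N.choose p.1 : ℂ) *
      (poch b p.1 * poch c p.1 * poch (d - x + p.1) p.2 * poch (d - b - c) p.2) =
    ∑ p ∈ antidiagonal N, (N.choose p.1 : ℂ) * ((-1) ^ p.1 * poch x p.1 * poch (d - b - c) p.1 *
      poch (d + p.1 - b) p.2 * poch (d + p.1 - c) p.2) := by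
  have h1 : ∀ p ∈ antidiagonal N, (N.choose p.1 : ℂ) *
      (poch b p.1 * poch c p.1 * poch (d - x + p.1) p.2 * poch (d - b - c) p.2) =
      ∑ q ∈ antidiagonal p.2, ((p.1 + (q.1 + q.2)).choose p.1 * (q.1 + q.2).choose q.1 : ℕ) *
        (poch b p.1 * poch c p.1 * ((-1) ^ q.1 * poch x q.1 * poch (d + p.1 + q.1) q.2)
          * poch (d - b - c) (q.1 + q.2)) := by
    intro p hp
    rw [show d - x + (p.1 : ℂ) = d + p.1 - x by ring, ← vandermonde2, Finset.mul_sum,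
      Finset.sum_mul, Finset.mul_sum]
    refine Finset.sum_congr rfl fun q hq => ?_
    rw [HasAntidiagonal.mem_antidiagonal] at hp hq
    rw [hq, hp]; push_cast; ring
  rw [Finset.sum_congr rfl h1, triple_swap N (fun m j k =>
    (((m + (j + k)).choose m * (j + k).choose j : ℕ) : ℂ) *
        (poch b m * poch c m * ((-1) ^ j * poch x j * poch (d + m + j) k)
          * poch (d - b - c) (j + k)))]
  refine Finset.sum_congr rfl fun p hp => ?_
  have := saal b c p.2 (d + p.1)
  rw [mul_assoc ((-1) ^ p.1 * poch x p.1 * poch (d - b - c) p.1), ← this, Finset.mul_sum,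
    Finset.mul_sum]
  refine Finset.sum_congr rfl fun q hq => ?_
  rw [HasAntidiagonal.mem_antidiagonal] at hp hq
  rw [choose_swap, hq, hp, poch_add, show d + (p.1 : ℂ) - b - c = d - b - c + p.1 by ring,
    show d + (p.1 : ℂ) + q.1 = d + q.1 + p.1 by ring]
  push_cast; ring

theorem inv_GammaSeq_tendsto (s : ℂ) :
    Filter.Tendsto (fun n => (Complex.GammaSeq s n)⁻¹) Filter.atTop (nhds (Complex.Gamma s)⁻¹) := by
  by_cases h : Complex.Gamma s = 0
  · obtain ⟨m, rfl⟩ := (Complex.Gamma_eq_zero_iff s).1 h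
    rw [h, inv_zero]
    refine tendsto_const_nhds.congr' ?_
    filter_upwards [Filter.eventually_ge_atTop m] with n hn
    have : ∏ j ∈ Finset.range (n + 1), (-(m : ℂ) + j) = 0 :=
      Finset.prod_eq_zero (Finset.mem_range.2 (Nat.lt_succ_of_le hn)) (by ring)
    simp [Complex.GammaSeq, this]
  · exact (Complex.GammaSeq_tendsto_Gamma s).inv₀ h

theorem GammaSeq_poch (s : ℂ) (n : ℕ) :
    Complex.GammaSeq s n = (n : ℂ) ^ s * (n.factorial : ℂ) / poch s (n + 1) := rfl

theorem poch_eq_inv_GammaSeq (s : ℂ) {n : ℕ} (hn : 1 ≤ n) :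
    poch s (n + 1) = (n : ℂ) ^ s * (n.factorial : ℂ) * (Complex.GammaSeq s n)⁻¹ := by
  have h1 : (n : ℂ) ≠ 0 := Nat.cast_ne_zero.2 (by omega)
  have h2 : (n : ℂ) ^ s ≠ 0 := by simp [Complex.cpow_eq_zero_iff, h1]
  have h3 : (n.factorial : ℂ) ≠ 0 := Nat.cast_ne_zero.2 (Nat.factorial_ne_zero n)
  rw [GammaSeq_poch, inv_div, mul_div_cancel₀ _ (mul_ne_zero h2 h3)]

theorem bdd_of_tendsto {u : ℕ → ℂ} {l : ℂ} (h : Filter.Tendsto u Filter.atTop (nhds l)) :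
    ∃ C : ℝ, 0 ≤ C ∧ ∀ n, ‖u n‖ ≤ C := by
  obtain ⟨C, hC⟩ := (Metric.isBounded_range_of_tendsto u h).exists_norm_le
  exact ⟨C, (norm_nonneg (u 0)).trans (hC _ ⟨0, rfl⟩), fun n => hC _ ⟨n, rfl⟩⟩

theorem poch_bound (a : ℂ) : ∃ C : ℝ, 0 ≤ C ∧ ∀ n : ℕ, 1 ≤ n →
    ‖poch a (n + 1)‖ ≤ C * ((n : ℝ) ^ a.re * n.factorial) := by
  obtain ⟨C, hC0, hC⟩ := bdd_of_tendsto (inv_GammaSeq_tendsto a)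
  refine ⟨C, hC0, fun n hn => ?_⟩
  rw [poch_eq_inv_GammaSeq a hn, norm_mul, norm_mul, Complex.norm_natCast_cpow_of_pos (by omega),
    Complex.norm_natCast, mul_comm]
  exact mul_le_mul_of_nonneg_right (hC n) (by positivity)

theorem poch_inv_bound (a : ℂ) : ∃ C : ℝ, 0 ≤ C ∧ ∀ n : ℕ, 1 ≤ n →
    ‖(poch a (n + 1))⁻¹‖ ≤ C * ((n : ℝ) ^ (-a.re) * (n.factorial : ℝ)⁻¹) := by
  obtain ⟨C, hC0, hC⟩ := bdd_of_tendsto (Complex.GammaSeq_tendsto_Gamma a)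
  refine ⟨C, hC0, fun n hn => ?_⟩
  rw [poch_eq_inv_GammaSeq a hn, mul_inv, inv_inv, mul_inv, norm_mul, norm_mul, norm_inv, norm_inv,
    Complex.norm_natCast_cpow_of_pos (by omega),
    Complex.norm_natCast, mul_comm, Real.rpow_neg (by positivity)]
  exact mul_le_mul_of_nonneg_right (hC n) (by positivity)

theorem t3_bound (a₁ a₂ a₃ b₁ b₂ : ℂ) : ∃ K : ℝ, 0 ≤ K ∧ ∀ n : ℕ, 1 ≤ n →
    ‖poch a₁ (n + 1) * poch a₂ (n + 1) * poch a₃ (n + 1) /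
      (poch b₁ (n + 1) * poch b₂ (n + 1) * ((n + 1).factorial : ℂ))‖
      ≤ K * (n : ℝ) ^ ((a₁ + a₂ + a₃ - b₁ - b₂).re - 1) := by
  obtain ⟨A, hA0, hA⟩ := poch_bound a₁
  obtain ⟨B, hB0, hB⟩ := poch_bound a₂
  obtain ⟨C, hC0, hC⟩ := poch_bound a₃
  obtain ⟨D, hD0, hD⟩ := poch_inv_bound b₁
  obtain ⟨E, hE0, hE⟩ := poch_inv_bound b₂
  obtain ⟨G, hG0, hG⟩ := poch_inv_bound 1
  refine ⟨A * B * C * (D * E * G), by positivity, fun n hn => ?_⟩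
  have hn0 : (0 : ℝ) < n := by exact_mod_cast hn
  have hf : (n.factorial : ℝ) ≠ 0 := Nat.cast_ne_zero.2 (Nat.factorial_ne_zero n)
  rw [← poch_one, div_eq_mul_inv, mul_inv, mul_inv, norm_mul, norm_mul, norm_mul, norm_mul, norm_mul]
  calc _ ≤ (A * ((n : ℝ) ^ a₁.re * n.factorial)) * (B * ((n : ℝ) ^ a₂.re * n.factorial)) *
        (C * ((n : ℝ) ^ a₃.re * n.factorial)) *
        ((D * ((n : ℝ) ^ (-b₁.re) * (n.factorial : ℝ)⁻¹)) *
          (E * ((n : ℝ) ^ (-b₂.re) * (n.factorial : ℝ)⁻¹)) *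
          (G * ((n : ℝ) ^ (-(1 : ℂ).re) * (n.factorial : ℝ)⁻¹))) := by
        have := hA n hn
        have := hB n hn
        have := hC n hn
        have := hD n hn
        have := hE n hn
        have := hG n hn
        gcongr
    _ = _ := by
        have : (n : ℝ) ^ ((a₁ + a₂ + a₃ - b₁ - b₂).re - 1) =
          (n : ℝ) ^ a₁.re * (n : ℝ) ^ a₂.re * (n : ℝ) ^ a₃.re * (n : ℝ) ^ (-b₁.re) *
            (n : ℝ) ^ (-b₂.re) * (n : ℝ) ^ (-(1 : ℂ).re) := by
          simp only [← Real.rpow_add hn0]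
          congr 1
        rw [this]
        field_simp

theorem t3_summable (a₁ a₂ a₃ b₁ b₂ : ℂ) (h : (a₁ + a₂ + a₃ - b₁ - b₂).re < 0) :
    Summable fun n : ℕ => poch a₁ n * poch a₂ n * poch a₃ n /
      (poch b₁ n * poch b₂ n * (n.factorial : ℂ)) := by
  obtain ⟨K, hK0, hK⟩ := t3_bound a₁ a₂ a₃ b₁ b₂
  rw [← summable_nat_add_iff 1]
  refine Summable.of_norm_bounded_eventually_nat
    (g := fun n : ℕ => K * (n : ℝ) ^ ((a₁ + a₂ + a₃ - b₁ - b₂).re - 1))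
    ((Real.summable_nat_rpow.2 (by linarith)).mul_left K) ?_
  filter_upwards [Filter.eventually_ge_atTop 1] with n hn
  exact hK n hn

/-- general term of the Gauss series -/
noncomputable def gaussT (a b c : ℂ) (n : ℕ) : ℂ :=
  poch a n * poch b n / (poch c n * (n.factorial : ℂ))

theorem gaussT_eq (a b c : ℂ) (n : ℕ) : gaussT a b c n =
    poch a n * poch b n * poch 1 n / (poch c n * poch 1 n * (n.factorial : ℂ)) := by
  have hf : (n.factorial : ℂ) ≠ 0 := Nat.cast_ne_zero.2 (Nat.factorial_ne_zero n)
  rw [gaussT, poch_one]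
  rw [show poch c n * (n.factorial : ℂ) * (n.factorial : ℂ)
    = (poch c n * (n.factorial : ℂ)) * (n.factorial : ℂ) by ring, mul_div_mul_right _ _ hf]

theorem gaussT_summable (a b c : ℂ) (h : 0 < (c - a - b).re) : Summable (gaussT a b c) := by
  have := t3_summable a b 1 c 1 (by simp only [add_re, sub_re] at h ⊢; linarith)
  exact this.congr fun n => (gaussT_eq a b c n).symm

theorem gaussT_mul_tendsto (a b c : ℂ) (h : 0 < (c - a - b).re) :
    Filter.Tendsto (fun n : ℕ => (n : ℂ) * gaussT a b c n) Filter.atTop (nhds 0) := by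
  obtain ⟨K, hK0, hK⟩ := t3_bound a b 1 c 1
  rw [← Filter.tendsto_add_atTop_iff_nat 1]
  have hlim : Filter.Tendsto (fun n : ℕ => 2 * K * (n : ℝ) ^ (-(c - a - b).re)) Filter.atTop
      (nhds 0) := by
    have := ((tendsto_rpow_neg_atTop h).comp tendsto_natCast_atTop_atTop).const_mul (2 * K)
    simpa using this
  refine squeeze_zero_norm' ?_ hlim
  filter_upwards [Filter.eventually_ge_atTop 1] with n hn
  have hn0 : (1 : ℝ) ≤ n := by exact_mod_cast hn
  have := hK n hn
  rw [← gaussT_eq] at this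
  have e : (n : ℝ) ^ (-(c - a - b).re) =
      (n : ℝ) ^ ((a + b + 1 - c - 1).re - 1) * n := by
    nth_rw 3 [← Real.rpow_one (n : ℝ)]
    rw [← Real.rpow_add (by linarith)]
    congr 1
    simp only [add_re, sub_re, one_re]; ring
  rw [norm_mul, Complex.norm_natCast, e]
  calc _ ≤ (2 * (n : ℝ)) * (K * (n : ℝ) ^ ((a + b + 1 - c - 1).re - 1)) := by
        gcongr
        push_cast; linarith
    _ = _ := by ring

theorem gaussT_contig_term (a b c : ℂ) (hc : notNonposInt c) (n : ℕ) :
    c * (c - a - b) * gaussT a b c n - (c - a) * (c - b) * gaussT a b (c + 1) n =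
    -c * (((n + 1 : ℕ) : ℂ) * gaussT a b c (n + 1)) - -c * ((n : ℂ) * gaussT a b c n) := by
  have hf : (n.factorial : ℂ) ≠ 0 := Nat.cast_ne_zero.2 (Nat.factorial_ne_zero n)
  have hp := poch_ne_zero hc n
  have hc0 : c ≠ 0 := by simpa using hc 0
  have hcn : c + n ≠ 0 := fun h => hc n (eq_neg_of_add_eq_zero_left h)
  have hn1 : ((n : ℂ) + 1) ≠ 0 := by exact_mod_cast Nat.succ_ne_zero n
  have h1 : poch (c + 1) n = poch c n * (c + n) / c := by
    rw [eq_div_iff hc0, mul_comm, ← poch_succ', poch_succ]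
  simp only [gaussT]
  rw [h1, poch_succ, poch_succ, poch_succ, Nat.factorial_succ]
  push_cast
  field_simp
  ring

theorem gauss_contig (a b c : ℂ) (hc : notNonposInt c) (h : 0 < (c - a - b).re) :
    c * (c - a - b) * ∑' n, gaussT a b c n = (c - a) * (c - b) * ∑' n, gaussT a b (c + 1) n := by
  have s1 := (gaussT_summable a b c h).hasSum.mul_left (c * (c - a - b))
  have s2 := (gaussT_summable a b (c + 1) (by
    simp only [add_re, sub_re, one_re] at h ⊢; linarith)).hasSum.mul_left ((c - a) * (c - b))
  have s3 := (s1.sub s2).tendsto_sum_nat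
  simp only [gaussT_contig_term a b c hc] at s3
  simp only [Finset.sum_range_sub (fun n : ℕ => -c * ((n : ℂ) * gaussT a b c n))] at s3
  have s4 := ((gaussT_mul_tendsto a b c h).const_mul (-c)).sub_const
    (-c * (((0 : ℕ) : ℂ) * gaussT a b c 0))
  have := tendsto_nhds_unique s3 s4
  simp only [Nat.cast_zero, zero_mul, mul_zero, sub_zero] at this
  exact sub_eq_zero.1 this

theorem notNonposInt_add {c : ℂ} (hc : notNonposInt c) (k : ℕ) : notNonposInt (c + k) := by
  intro j hj
  apply hc (j + k)
  push_cast
  linear_combination hj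

theorem gauss_iter (a b c : ℂ) (hc : notNonposInt c) (h : 0 < (c - a - b).re) (k : ℕ) :
    poch c k * poch (c - a - b) k * ∑' n, gaussT a b c n =
      poch (c - a) k * poch (c - b) k * ∑' n, gaussT a b (c + k) n := by
  induction k with
  | zero => simp [poch]
  | succ k ih =>
    have := gauss_contig a b (c + k) (notNonposInt_add hc k) (by
      simp only [add_re, sub_re, natCast_re] at h ⊢
      have : (0 : ℝ) ≤ k := Nat.cast_nonneg k
      linarith)
    simp only [poch_succ]
    push_cast
    rw [← add_assoc c]
    linear_combination ((c + k) * (c - a - b + k)) * ih + poch (c - a) k * poch (c - b) k * this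

theorem norm_poch_le (a : ℂ) (n : ℕ) : ‖poch a n‖ ≤ ‖poch (‖a‖ : ℂ) n‖ := by
  simp only [poch, norm_prod]
  refine Finset.prod_le_prod (fun _ _ => norm_nonneg _) fun i _ => ?_
  have : ‖((‖a‖ : ℂ) + i)‖ = ‖a‖ + i := by
    rw [← Complex.ofReal_natCast, ← Complex.ofReal_add, Complex.norm_real, Real.norm_of_nonneg]
    positivity
  rw [this]
  exact (norm_add_le _ _).trans (by simp)

theorem norm_poch_ge (c : ℂ) (r : ℝ) (hr : 0 < r) (h : r ≤ c.re) (n : ℕ) :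
    ‖poch (r : ℂ) n‖ ≤ ‖poch c n‖ := by
  simp only [poch, norm_prod]
  refine Finset.prod_le_prod (fun _ _ => norm_nonneg _) fun i _ => ?_
  have : ‖((r : ℂ) + i)‖ = r + i := by
    rw [← Complex.ofReal_natCast, ← Complex.ofReal_add, Complex.norm_real, Real.norm_of_nonneg]
    positivity
  rw [this]
  refine le_trans ?_ (Complex.re_le_norm _)
  simpa using h

theorem gauss_tendsto_one (a b c : ℂ) :
    Filter.Tendsto (fun k : ℕ => ∑' n, gaussT a b (c + k) n) Filter.atTop (nhds 1) := by
  obtain ⟨K, hK⟩ := exists_nat_gt (‖a‖ + ‖b‖ - c.re)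
  set r : ℝ := c.re + K with hr
  have hr0 : 0 < r := by
    have := norm_nonneg a; have := norm_nonneg b; linarith
  have hs : Summable fun n => ‖gaussT (‖a‖ : ℂ) (‖b‖ : ℂ) (r : ℂ) n‖ := by
    refine (gaussT_summable _ _ _ ?_).norm
    simp only [sub_re, ofReal_re]; linarith
  have key := tendsto_tsum_of_dominated_convergence (𝓕 := Filter.atTop)
    (f := fun (k : ℕ) n => gaussT a b (c + k) n) (g := fun n => if n = 0 then (1 : ℂ) else 0) hs
    ?_ ?_
  · simpa using key
  · intro n
    rcases n with _ | m
    · simp [gaussT, poch]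
    simp only [Nat.add_eq_zero_iff, one_ne_zero, and_false, if_false]
    have hinv : Filter.Tendsto (fun k : ℕ => (poch (c + k) (m + 1))⁻¹) Filter.atTop (nhds 0) := by
      have h1 : ∀ i ∈ Finset.range (m + 1),
          Filter.Tendsto (fun k : ℕ => (c + k + i)⁻¹) Filter.atTop (nhds (0 : ℂ)) := by
        intro i _
        refine Filter.tendsto_inv₀_cobounded.comp (tendsto_norm_atTop_iff_cobounded.1 ?_)
        refine Filter.tendsto_atTop_mono (fun k => Complex.re_le_norm _) ?_
        simp only [add_re, natCast_re]
        exact Filter.tendsto_atTop_add_const_right _ _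
          (Filter.tendsto_atTop_add_const_left _ _ tendsto_natCast_atTop_atTop)
      have := tendsto_finsetProd _ h1
      simpa [poch] using this
    have := hinv.const_mul (poch a (m + 1) * poch b (m + 1) * ((m + 1).factorial : ℂ)⁻¹)
    rw [mul_zero] at this
    refine this.congr fun k => ?_
    rw [gaussT, div_eq_mul_inv, mul_inv]; ring
  · filter_upwards [Filter.eventually_ge_atTop K] with k hk n
    have hk' : (K : ℝ) ≤ k := by exact_mod_cast hk
    have hpos : 0 < ‖poch (r : ℂ) n‖ := by
      rw [norm_pos_iff]
      apply poch_ne_zero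
      intro j hj
      have := congrArg Complex.re hj
      simp at this
      have h0 : (0 : ℝ) ≤ j := Nat.cast_nonneg j
      linarith
    have hf : (0 : ℝ) < n.factorial := by exact_mod_cast Nat.factorial_pos n
    have h1 := norm_poch_le a n
    have h2 := norm_poch_le b n
    have h3 := norm_poch_ge (c + k) r hr0 (by simp [hr, hk']) n
    simp only [gaussT, norm_div, norm_mul, Complex.norm_natCast]
    gcongr

theorem gauss_sum (a b c : ℂ) (hc : notNonposInt c) (h : 0 < (c - a - b).re) :
    HasSum (gaussT a b c) (Complex.Gamma c * Complex.Gamma (c - a - b) /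
      (Complex.Gamma (c - a) * Complex.Gamma (c - b))) := by
  have hsum := (gaussT_summable a b c h).hasSum
  have hcab : notNonposInt (c - a - b) := by
    intro j hj
    rw [hj] at h
    simp at h
    have h0 : (0 : ℝ) ≤ j := Nat.cast_nonneg j
    linarith
  have l1 := ((((Complex.GammaSeq_tendsto_Gamma c).mul (Complex.GammaSeq_tendsto_Gamma (c - a - b))).mul
    ((inv_GammaSeq_tendsto (c - a)).mul (inv_GammaSeq_tendsto (c - b))))).mul
    ((Filter.tendsto_add_atTop_iff_nat 1).2 (gauss_tendsto_one a b c))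
  have l2 : Filter.Tendsto (fun _ : ℕ => ∑' n, gaussT a b c n) Filter.atTop
      (nhds (∑' n, gaussT a b c n)) := tendsto_const_nhds
  have := tendsto_nhds_unique (l2.congr' ?_) l1
  · rw [this] at hsum
    convert hsum using 1
    rw [mul_one, div_eq_mul_inv, mul_inv]
  · filter_upwards [Filter.eventually_ge_atTop 1] with k hk
    have hit := gauss_iter a b c hc h (k + 1)
    have p1 := poch_ne_zero hc (k + 1)
    have p2 := poch_ne_zero hcab (k + 1)
    have h1 : (k : ℂ) ≠ 0 := Nat.cast_ne_zero.2 (by omega)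
    have h2 : ∀ s : ℂ, (k : ℂ) ^ s ≠ 0 := fun s => by simp [Complex.cpow_eq_zero_iff, h1]
    have h3 : (k.factorial : ℂ) ≠ 0 := Nat.cast_ne_zero.2 (Nat.factorial_ne_zero k)
    have e : (k : ℂ) ^ c * (k : ℂ) ^ (c - a - b) = (k : ℂ) ^ (c - a) * (k : ℂ) ^ (c - b) := by
      rw [← Complex.cpow_add _ _ h1, ← Complex.cpow_add _ _ h1]; congr 1; ring
    simp only [GammaSeq_poch, inv_div]
    have hS : ∑' n, gaussT a b c n = poch (c - a) (k + 1) * poch (c - b) (k + 1) *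
        (∑' n, gaussT a b (c + ((k + 1 : ℕ) : ℂ)) n) / (poch c (k + 1) * poch (c - a - b) (k + 1)) := by
      rw [eq_div_iff (mul_ne_zero p1 p2), ← hit]; ring
    rw [hS]
    have q1 := h2 (c - a)
    have q2 := h2 (c - b)
    field_simp
    linear_combination (-(poch (c - a) (k + 1) * poch (c - b) (k + 1) *
        (∑' n, gaussT a b (c + ((k + 1 : ℕ) : ℂ)) n))) * e

theorem neg_poch (N m : ℕ) : poch (-(N : ℂ)) m = (-1) ^ m * ((N.choose m : ℂ) * m.factorial) := by
  induction m with
  | zero => simp [poch]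
  | succ m ih =>
    have h : (N.choose (m + 1) : ℂ) * (m + 1) = N.choose m * ((N : ℂ) - m) := by
      rcases le_or_gt m N with hm | hm
      · rw [← Nat.cast_sub hm]
        exact_mod_cast Nat.choose_succ_right_eq N m
      · simp [Nat.choose_eq_zero_of_lt hm, Nat.choose_eq_zero_of_lt (Nat.lt_succ_of_lt hm)]
    rw [poch_succ, ih, Nat.factorial_succ]
    push_cast
    linear_combination ((-1) ^ m * (m.factorial : ℂ)) * h

theorem Gamma_add_poch {z : ℂ} (hz : notNonposInt z) (k : ℕ) :
    Complex.Gamma (z + k) = poch z k * Complex.Gamma z := by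
  induction k with
  | zero => simp [poch]
  | succ k ih =>
    have : z + k ≠ 0 := fun h => hz k (eq_neg_of_add_eq_zero_left h)
    push_cast
    rw [← add_assoc, Complex.Gamma_add_one _ this, ih, poch_succ]; ring

theorem notNonposInt_of_re_pos {z : ℂ} (h : 0 < z.re) : notNonposInt z := by
  intro j hj
  rw [hj] at h
  simp at h
  have h0 : (0 : ℝ) ≤ j := Nat.cast_nonneg j
  linarith

theorem hasSum_cast {f g : ℕ → ℂ} {x y : ℂ} (h : HasSum f x) (h1 : ∀ n, g n = f n) (h2 : y = x) :
    HasSum g y := by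
  rw [h2, funext h1]; exact h

theorem gauss_falling (A B e : ℂ) (he : notNonposInt e) (j : ℕ) (h : 0 < (e - A - B - j).re) :
    HasSum (fun n : ℕ => gaussT A B e n * ((-1) ^ j * poch (-(n : ℂ)) j))
      (poch A j * poch B j * (Complex.Gamma e * Complex.Gamma (e - A - B - j) /
        (Complex.Gamma (e - A) * Complex.Gamma (e - B)))) := by
  have hg := gauss_sum (A + j) (B + j) (e + j) (notNonposInt_add he j) (by
    rw [show e + j - (A + j) - (B + j) = e - A - B - j by ring]; exact h)
  have hg' := hg.mul_left (poch A j * poch B j / poch e j)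
  have hej := poch_ne_zero he j
  rw [← (add_left_injective j).hasSum_iff]
  · refine hasSum_cast hg' ?_ ?_
    · intro i
      simp only [Function.comp, gaussT]
      have hc : ((i + j).choose j : ℂ) * j.factorial * i.factorial = (i + j).factorial := by
        have := Nat.add_choose_mul_factorial_mul_factorial i j
        rw [← this]; push_cast; ring
      have hf1 : (i.factorial : ℂ) ≠ 0 := Nat.cast_ne_zero.2 (Nat.factorial_ne_zero i)
      have hf2 : ((i + j).factorial : ℂ) ≠ 0 := Nat.cast_ne_zero.2 (Nat.factorial_ne_zero _)
      have hei := poch_ne_zero (notNonposInt_add he j) i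
      have hs : ((-1 : ℂ) ^ j) * (-1) ^ j = 1 := by rw [← mul_pow]; simp
      rw [neg_poch, ← mul_assoc ((-1 : ℂ) ^ j), hs, one_mul, add_comm i j, poch_add, poch_add,
        poch_add, add_comm j i]
      field_simp
      linear_combination (poch A j * poch B j * poch (A + j) i * poch (B + j) i) * hc
    · rw [show e + j - (A + j) - (B + j) = e - A - B - j by ring,
        show e + j - (A + j) = e - A by ring, show e + j - (B + j) = e - B by ring,
        Gamma_add_poch he]
      field_simp
  · intro n hn
    have : n < j := by
      by_contra hh
      exact hn ⟨n - j, by simp; omega⟩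
    rw [neg_poch, Nat.choose_eq_zero_of_lt this]
    simp

theorem term_eq (N m l : ℕ) (hml : m + l = N) (b c d e' : ℂ) (hd : notNonposInt d)
    (he : notNonposInt (1 - N + b + c - d)) (hδ : poch (d - b - c) N ≠ 0)
    (hee : notNonposInt e') (n : ℕ) :
    poch (-(N : ℂ)) m * poch b m * poch c m *
            poch (d + N) n * poch (d - b) n * poch (d - c) n /
          (poch d (m + n) * poch (1 - N + b + c - d) m * poch e' n *
            (Nat.factorial m : ℂ) * (Nat.factorial n : ℂ)) =
    (poch d N * poch (d - b - c) N)⁻¹ * gaussT (d - b) (d - c) e' n *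
      ((N.choose m : ℂ) * (poch b m * poch c m * poch (d - (-(n : ℂ)) + m) l
        * poch (d - b - c) l)) := by
  have hN : (N : ℂ) = m + l := by rw [← hml]; push_cast; ring
  have h1 : poch (1 - N + b + c - d) m = (-1) ^ m * poch (d - b - c + l) m := by
    rw [← poch_reflect, hN]; congr 1; ring
  have h2 : poch (d - b - c) N = poch (d - b - c) l * poch (d - b - c + l) m := by
    rw [← poch_add, ← hml, add_comm]
  have h3 : poch d N * poch (d + N) n = poch d (m + n) * poch (d - (-(n : ℂ)) + m) l := by
    rw [← poch_add, show d - (-(n : ℂ)) + m = d + ((m + n : ℕ) : ℂ) by push_cast; ring, ← poch_add]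
    congr 1; omega
  have n1 := poch_ne_zero hd (m + n)
  have n2 := poch_ne_zero hd N
  have n3 := poch_ne_zero he m
  have n4 := poch_ne_zero hee n
  have n5 : (m.factorial : ℂ) ≠ 0 := Nat.cast_ne_zero.2 (Nat.factorial_ne_zero m)
  have n6 : (n.factorial : ℂ) ≠ 0 := Nat.cast_ne_zero.2 (Nat.factorial_ne_zero n)
  have n7 : poch (d - b - c) l ≠ 0 := by rw [h2] at hδ; exact left_ne_zero_of_mul hδ
  have n8 : poch (d - b - c + l) m ≠ 0 := by rw [h2] at hδ; exact right_ne_zero_of_mul hδ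
  have n9 : ((-1 : ℂ) ^ m) ≠ 0 := pow_ne_zero _ (by norm_num)
  rw [h1, h2, neg_poch, gaussT]
  field_simp
  linear_combination ((N.choose m : ℂ) * poch b m * poch c m * poch (d - b) n * poch (d - c) n) * h3

theorem delta_ne_zero (N : ℕ) (b c d : ℂ) (he : notNonposInt (1 - N + b + c - d)) :
    poch (d - b - c) N ≠ 0 := by
  rw [poch, Finset.prod_ne_zero_iff]
  intro i hi h0
  have hi' := Finset.mem_range.mp hi
  apply he (N - 1 - i)
  rw [Nat.cast_sub (by omega), Nat.cast_sub (by omega)]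
  push_cast
  linear_combination -h0

theorem kdf_summation_g1 (N : ℕ) (hN : 0 < N) (b c d e' : ℂ)
    (hconv : 0 < (e' - N + b + c - 2 * d).re)
    (hd : notNonposInt d) (he : notNonposInt (1 - N + b + c - d))
    (hee : notNonposInt e') :
    (∑' (m : ℕ) (n : ℕ),
        poch (-(N : ℂ)) m * poch b m * poch c m *
            poch (d + N) n * poch (d - b) n * poch (d - c) n /
          (poch d (m + n) * poch (1 - N + b + c - d) m * poch e' n *
            (Nat.factorial m : ℂ) * (Nat.factorial n : ℂ))) =
      poch (d - b) N * poch (d - c) N * poch (1 + d - e') N /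
          (poch d N * poch (d - b - c) N * poch (1 + 2 * d - b - c - e') N) *
        (Complex.Gamma e' * Complex.Gamma (e' + b + c - 2 * d) /
          (Complex.Gamma (e' + b - d) * Complex.Gamma (e' + c - d))) := by
  have hδ := delta_ne_zero N b c d he
  -- the outer sum is finite
  rw [tsum_eq_sum (s := Finset.range (N + 1)) (by
    intro m hm
    have hm' : N < m := by simpa using hm
    simp [neg_poch, Nat.choose_eq_zero_of_lt hm'])]
  rw [← Finset.Nat.sum_antidiagonal_eq_sum_range_succ_mk (fun p : ℕ × ℕ => ∑' n : ℕ,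
    poch (-(N : ℂ)) p.1 * poch b p.1 * poch c p.1 *
            poch (d + N) n * poch (d - b) n * poch (d - c) n /
          (poch d (p.1 + n) * poch (1 - N + b + c - d) p.1 * poch e' n *
            (Nat.factorial p.1 : ℂ) * (Nat.factorial n : ℂ)))]
  -- exchange
  rw [← Summable.tsum_finsetSum]
  swap
  · intro p hp
    have ht := t3_summable (d + N) (d - b) (d - c) (d + p.1) e' (by
      have h0 : (0 : ℝ) ≤ (p.1 : ℝ) := Nat.cast_nonneg _
      simp only [add_re, sub_re, natCast_re, mul_re, re_ofNat, im_ofNat, zero_mul] at hconv ⊢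
      linarith)
    refine (ht.mul_left (poch (-(N : ℂ)) p.1 * poch b p.1 * poch c p.1 /
      (poch d p.1 * poch (1 - N + b + c - d) p.1 * (p.1.factorial : ℂ)))).congr fun n => ?_
    rw [poch_add d, div_mul_div_comm]
    congr 1 <;> ring
  set σ : ℂ := e' - N + b + c - 2 * d with hσ
  have hσn : notNonposInt σ := notNonposInt_of_re_pos hconv
  have hpt : ∀ n : ℕ, ∑ p ∈ HasAntidiagonal.antidiagonal N,
      poch (-(N : ℂ)) p.1 * poch b p.1 * poch c p.1 *
            poch (d + N) n * poch (d - b) n * poch (d - c) n /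
          (poch d (p.1 + n) * poch (1 - N + b + c - d) p.1 * poch e' n *
            (Nat.factorial p.1 : ℂ) * (Nat.factorial n : ℂ)) =
      ∑ p ∈ HasAntidiagonal.antidiagonal N, ((poch d N * poch (d - b - c) N)⁻¹ *
        ((N.choose p.1 : ℂ) * (poch (d - b - c) p.1 *
          poch (d + p.1 - b) p.2 * poch (d + p.1 - c) p.2))) *
        (gaussT (d - b) (d - c) e' n * ((-1) ^ p.1 * poch (-(n : ℂ)) p.1)) := by
    intro n
    rw [Finset.sum_congr rfl fun p hp => term_eq N p.1 p.2
      (HasAntidiagonal.mem_antidiagonal.mp hp) b c d e' hd he hδ hee n]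
    rw [← Finset.mul_sum, L_identity, Finset.mul_sum]
    refine Finset.sum_congr rfl fun p _ => ?_
    ring
  simp only [hpt]
  have hsum : ∀ p ∈ HasAntidiagonal.antidiagonal N, HasSum (fun n : ℕ =>
      ((poch d N * poch (d - b - c) N)⁻¹ *
        ((N.choose p.1 : ℂ) * (poch (d - b - c) p.1 *
          poch (d + p.1 - b) p.2 * poch (d + p.1 - c) p.2))) *
        (gaussT (d - b) (d - c) e' n * ((-1) ^ p.1 * poch (-(n : ℂ)) p.1)))
      (((poch d N * poch (d - b - c) N)⁻¹ * poch (d - b) N * poch (d - c) N *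
        (Complex.Gamma e' * Complex.Gamma σ /
          (Complex.Gamma (e' + b - d) * Complex.Gamma (e' + c - d)))) *
        ((N.choose p.1 : ℂ) * (poch (d - b - c) p.1 * poch σ p.2))) := by
    intro p hp
    have hp' := HasAntidiagonal.mem_antidiagonal.mp hp
    have hNc : (N : ℂ) = p.1 + p.2 := by rw [← hp']; push_cast; ring
    have eσ : e' - (d - b) - (d - c) - p.1 = σ + p.2 := by rw [hσ, hNc]; ring
    have hfall := gauss_falling (d - b) (d - c) e' hee p.1 (by
      rw [eσ]; simp only [add_re, natCast_re]
      have h0 : (0 : ℝ) ≤ (p.2 : ℝ) := Nat.cast_nonneg _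
      linarith)
    refine hasSum_cast (hfall.mul_left _) (fun n => rfl) ?_
    rw [eσ, Gamma_add_poch hσn, show e' - (d - b) = e' + b - d by ring,
      show e' - (d - c) = e' + c - d by ring, ← hp', poch_add (d - b), poch_add (d - c),
      show d + (p.1 : ℂ) - b = d - b + p.1 by ring, show d + (p.1 : ℂ) - c = d - c + p.1 by ring]
    ring
  rw [(hasSum_sum hsum).tsum_eq, ← Finset.mul_sum, vandermonde1]
  have r1 : poch (d - b - c + σ) N = (-1) ^ N * poch (1 + d - e') N := by
    rw [← poch_reflect]; congr 1; rw [hσ]; ring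
  have r2 : poch σ N = (-1) ^ N * poch (1 + 2 * d - b - c - e') N := by
    rw [← poch_reflect]; congr 1; rw [hσ]; ring
  have r3 : Complex.Gamma (e' + b + c - 2 * d) = poch σ N * Complex.Gamma σ := by
    rw [← Gamma_add_poch hσn]; congr 1; rw [hσ]; ring
  have n1 := poch_ne_zero hσn N
  have n2 : poch (1 + 2 * d - b - c - e') N ≠ 0 := by
    rw [r2] at n1; exact right_ne_zero_of_mul n1
  rw [r1, r3, r2]
  generalize poch (1 + 2 * d - b - c - e') N = Z at n2
  simp only [div_eq_mul_inv, mul_inv]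
  field_simp
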